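/- arXiv:1111.4082 — 4 statements merged into one kernel-verified Lean document; each statement's English description precedes it below -/
import Mathlib

section
/- Let k be a number field and let C ∈ k[x_1,…,x_5,y_1,…,y_h] be a cubic form in n = h + 5 variables which is irreducible over an algebraic closure of k, is non-conical, has h-invariant h_k(C) = h, and satisfies C(x,0) ≡ 0 (so that the linear space {y_1 = ⋯ = y_h = 0} lies on the hypersurface C = 0). Write C(x,y) = Σ_{i=1}^h y_i Q_i(x) + 2 Σ_{j=1}^5 x_j q_j(y) + c(y), where the Q_i are quadratic forms in x, the q_j are quadratic forms in y, and c is a cubic form in y, and let A(y) be the symmetric 6×6 matrix with upper-left 5×5 block Σ_{i=1}^h y_i M_i (where Q_i(x) = xᵀM_i x), last column and row (q_1(y),…,q_5(y)), and lower-right entry c(y), so that Q_y(x,t) := (x,t)ᵀ A(y) (x,t) satisfies Q_y(x,t)·t = C(x, t·y). Then either some 5×5 minor of A(y) is a nonzero polynomial in k[y_1,…,y_h] (so A(y) has rank at least 5 for all y outside a proper Zariski-closed subset), or the hypersurface C = 0 has a singular k-point, i.e. there is a nonzero a ∈ k^n at which all partial derivatives of C vanish. -/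
open MvPolynomial Matrix

/-- The form `C` is non-conical: there is no nonzero vector `b` over an algebraic closure
of `k` such that `C(x + s • b) = C(x)` identically in `x` and `s`. -/
def IsNonConical (k : Type) [Field k] {σ : Type} (C : MvPolynomial σ k) : Prop :=
  ¬ ∃ b : σ → AlgebraicClosure k, b ≠ 0 ∧
      ∀ (x : σ → AlgebraicClosure k) (s : AlgebraicClosure k),
        aeval (fun i => x i + s * b i) C = aeval x C

/-- The `h`-invariant of a cubic form `C` over `k`: the least positive integer `h` such
that `C = ∑ i in Fin h, L i * Q i` identically for some linear forms `L i` and quadratic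
forms `Q i` with coefficients in `k`. -/
noncomputable def hInvariant (k : Type) [Field k] {σ : Type} (C : MvPolynomial σ k) : ℕ :=
  sInf {h : ℕ | 0 < h ∧ ∃ L Q : Fin h → MvPolynomial σ k,
    (∀ i, (L i).IsHomogeneous 1) ∧ (∀ i, (Q i).IsHomogeneous 2) ∧ C = ∑ i, L i * Q i}

/-- A kernel vector of a linear system of symmetric matrices `∑ i, X i * M i` over a
polynomial ring is isotropic for every `M i`. -/
theorem isotropic_of_linear_pencil_mulVec_eq_zero {R ι n : Type*} [CommRing R] [Fintype ι]
    [Fintype n] (M : ι → Matrix n n R) (hM : ∀ i, (M i).IsSymm) (v : n → MvPolynomial ι R)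
    (hv : (Matrix.of fun a b => ∑ i, X i * MvPolynomial.C (M i a b)) *ᵥ v = 0) (i : ι) :
    v ⬝ᵥ ((M i).map MvPolynomial.C *ᵥ v) = 0 := by
  classical
  set B : Matrix n n (MvPolynomial ι R) :=
    Matrix.of fun a b => ∑ i, X i * MvPolynomial.C (M i a b) with hB
  have hBsymm : ∀ a b, B a b = B b a := fun a b => by
    simp only [hB, of_apply, fun i => (hM i).apply a b]
  have hBd : ∀ a b, pderiv i (B a b) = MvPolynomial.C (M i a b) := fun a b => by
    simp [hB, pderiv_X, Pi.single_apply]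
  have hrow : ∀ a, ∑ b, B a b * v b = 0 := fun a => congrFun hv a
  have hcol : ∑ a, v a * ∑ b, B a b * pderiv i (v b) = 0 := by
    simp_rw [Finset.mul_sum]
    rw [Finset.sum_comm]
    refine Finset.sum_eq_zero fun b _ => ?_
    calc ∑ a, v a * (B a b * pderiv i (v b)) = (∑ a, B b a * v a) * pderiv i (v b) := by
          rw [Finset.sum_mul]
          exact Finset.sum_congr rfl fun a _ => by rw [hBsymm a b]; ring
      _ = 0 := by rw [hrow, zero_mul]
  have hder : ∀ a, ∑ b, B a b * pderiv i (v b) + ∑ b, MvPolynomial.C (M i a b) * v b = 0 :=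
    fun a => by
      have := congrArg (pderiv i) (hrow a)
      simp only [map_sum, Derivation.leibniz, smul_eq_mul, hBd, map_zero] at this
      rw [← this, ← Finset.sum_add_distrib]
      exact Finset.sum_congr rfl fun b _ => by ring
  have hsum := Finset.sum_eq_zero (s := Finset.univ) fun a _ =>
    (congrArg (v a * ·) (hder a)).trans (mul_zero _)
  simpa only [mul_add, Finset.sum_add_distrib, hcol, zero_add, dotProduct, mulVec, map_apply]
    using hsum

/-- A homogeneous polynomial of nonzero degree has no constant term. -/
theorem MvPolynomial.IsHomogeneous.constantCoeff_eq_zero {R σ : Type*} [CommSemiring R]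
    {p : MvPolynomial σ R} {n : ℕ} (hp : p.IsHomogeneous n) (hn : n ≠ 0) :
    constantCoeff p = 0 := by
  rw [constantCoeff_eq]
  exact hp.coeff_eq_zero (by simpa using hn.symm)

/-- In variables `(x, y)`, a form of degree at least two in `y` alone has vanishing gradient
along `y = 0`. -/
theorem eval_pderiv_rename_inr_eq_zero {R σ τ : Type*} [CommSemiring R]
    {p : MvPolynomial τ R} {n : ℕ} (hp : p.IsHomogeneous n) (hn : 2 ≤ n) (x : σ → R)
    (v : σ ⊕ τ) :
    eval (Sum.elim x 0) (pderiv v (rename Sum.inr p)) = 0 := by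
  classical
  cases v with
  | inl j =>
    rw [pderiv_eq_zero_of_notMem_vars, map_zero]
    intro hj
    have := vars_rename _ _ hj
    simp at this
  | inr i =>
    rw [pderiv_rename Sum.inr_injective, eval_rename, Sum.elim_comp_inr, eval_zero]
    exact hp.pderiv.constantCoeff_eq_zero (by omega)

/-- The cubic form `∑ yᵢ Qᵢ(x) + 2 ∑ xⱼ qⱼ(y) + c(y)` is singular at each `(x, 0)` for which `x`
is a common zero of the `Qᵢ`. -/
theorem eval_pderiv_eq_zero_of_common_zero {R σ τ : Type*} [CommSemiring R] [Fintype σ] [Fintype τ]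
    {Q : τ → MvPolynomial σ R} {q : σ → MvPolynomial τ R} {c : MvPolynomial τ R}
    (hq : ∀ j, (q j).IsHomogeneous 2) (hc : c.IsHomogeneous 3) {x : σ → R}
    (hx : ∀ i, eval x (Q i) = 0) (v : σ ⊕ τ) :
    eval (Sum.elim x 0) (pderiv v (∑ i, X (Sum.inr i) * rename Sum.inl (Q i)
      + 2 * ∑ j, X (Sum.inl j) * rename Sum.inr (q j) + rename Sum.inr c)) = 0 := by
  have h2 : pderiv v (2 : MvPolynomial (σ ⊕ τ) R) = 0 := (pderiv v).map_natCast 2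
  simp [Derivation.leibniz, h2, eval_rename, hx, eval_pderiv_rename_inr_eq_zero hc,
    eval_pderiv_rename_inr_eq_zero (hq _), (hq _).constantCoeff_eq_zero two_ne_zero]

/-- **Lemma 6.** Let `C(x, y)` be a geometrically irreducible, non-conical cubic form over
a number field `k` in variables `x = (x₁, …, x₅)`, `y = (y₁, …, y_h)` with `h`-invariant
`h`, vanishing on the linear space `y = 0`, written as
`C(x,y) = ∑ᵢ yᵢ Qᵢ(x) + 2 ∑ⱼ xⱼ qⱼ(y) + c(y)` with `Qᵢ(x) = xᵀ Mᵢ x`.  Let `A(y)` be the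
symmetric `6 × 6` matrix with upper-left block `∑ᵢ yᵢ Mᵢ`, last column and row
`(q₁(y), …, q₅(y))`, and lower-right entry `c(y)`.  Then either some `5 × 5` minor of
`A(y)` is a nonzero polynomial in `k[y₁, …, y_h]`, or the hypersurface `C = 0` has a
singular `k`-point. -/
theorem minor_ne_zero_or_singular_point
    (k : Type) [Field k] [NumberField k] {h : ℕ}
    (C : MvPolynomial (Fin 5 ⊕ Fin h) k) (hC0 : C ≠ 0) (hhom : C.IsHomogeneous 3)
    (hgeomint : Irreducible (MvPolynomial.map (algebraMap k (AlgebraicClosure k)) C))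
    (hnc : IsNonConical k C)
    (hinv : hInvariant k C = h)
    (hvanish : aeval (Sum.elim X fun _ => (0 : MvPolynomial (Fin 5) k)) C = 0)
    (Q : Fin h → MvPolynomial (Fin 5) k) (q : Fin 5 → MvPolynomial (Fin h) k)
    (c : MvPolynomial (Fin h) k)
    (hQ : ∀ i, (Q i).IsHomogeneous 2) (hq : ∀ j, (q j).IsHomogeneous 2)
    (hc : c.IsHomogeneous 3)
    (hdecomp : C = ∑ i, X (Sum.inr i) * rename Sum.inl (Q i)
        + 2 * ∑ j, X (Sum.inl j) * rename Sum.inr (q j)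
        + rename Sum.inr c)
    (M : Fin h → Matrix (Fin 5) (Fin 5) k)
    (hMsymm : ∀ i, (M i).IsSymm)
    (hM : ∀ i, ∀ x : Fin 5 → k, eval x (Q i) = x ⬝ᵥ (M i).mulVec x)
    (A : Matrix (Fin 5 ⊕ Unit) (Fin 5 ⊕ Unit) (MvPolynomial (Fin h) k))
    (hA : A = Matrix.fromBlocks
        (Matrix.of fun a b => ∑ i, X i * MvPolynomial.C (M i a b))
        (Matrix.of fun a (_ : Unit) => q a)
        (Matrix.of fun (_ : Unit) b => q b)
        (Matrix.of fun (_ : Unit) (_ : Unit) => c)) :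
    (∃ r s : Fin 5 → Fin 5 ⊕ Unit, Function.Injective r ∧ Function.Injective s ∧
        (A.submatrix r s).det ≠ 0) ∨
      ∃ a : Fin 5 ⊕ Fin h → k, a ≠ 0 ∧ ∀ v, eval a (pderiv v C) = 0 := by
  by_cases hdet : (Matrix.of fun a b => ∑ i, X i * MvPolynomial.C (M i a b) :
      Matrix (Fin 5) (Fin 5) (MvPolynomial (Fin h) k)).det = 0
  · right
    obtain ⟨v, hv0, hv⟩ := Matrix.exists_mulVec_eq_zero_iff.2 hdet
    obtain ⟨j, hj⟩ := Function.ne_iff.1 hv0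
    obtain ⟨y, hy⟩ : ∃ y, eval y (v j) ≠ 0 := by
      by_contra! hy
      exact hj (MvPolynomial.funext fun y => by simpa using hy y)
    refine ⟨Sum.elim (fun a => eval y (v a)) 0, fun h0 => hy (congrFun h0 (Sum.inl j)), ?_⟩
    rw [hdecomp]
    refine eval_pderiv_eq_zero_of_common_zero hq hc fun i => ?_
    have hi := congrArg (eval y) (isotropic_of_linear_pencil_mulVec_eq_zero M hMsymm v hv i)
    simpa [hM, dotProduct, mulVec] using hi
  · left
    refine ⟨Sum.inl, Sum.inl, Sum.inl_injective, Sum.inl_injective, ?_⟩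
    rw [hA]
    exact hdet
end

section
/- Let k be a number field and let M_1,…,M_μ be ρ×ρ symmetric matrices with entries in k. Suppose that for every invertible ρ×ρ matrix B over k and every index i ∈ {1,…,ρ}, there exists some j ∈ {1,…,μ} such that the i-th diagonal entry of BᵀM_jB is nonzero. Then the polynomial det(Σ_{j=1}^μ y_j M_j) ∈ k[y_1,…,y_μ] is not identically zero; equivalently, det(Σ_{j=1}^μ b_j M_j) ≠ 0 for all (b_1,…,b_μ) outside a proper Zariski-closed subset of affine μ-space. -/
open MvPolynomial Matrix

/-- If a symmetric matrix `N` kills a vector `v`, then the entrywise derivative of `N` along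
any derivation, viewed as a quadratic form, vanishes at `v`. -/
theorem dotProduct_map_derivation_mulVec_eq_zero {R A n : Type*} [CommRing R] [CommRing A]
    [Algebra R A] [Fintype n] (D : Derivation R A A) {N : Matrix n n A} (hN : N.IsSymm)
    {v : n → A} (hv : N *ᵥ v = 0) : v ⬝ᵥ (N.map D *ᵥ v) = 0 := by
  have hD : N *ᵥ (fun b => D (v b)) + N.map D *ᵥ v = 0 := by
    funext a
    have h := congrArg D (congrFun hv a)
    simpa [mulVec, dotProduct, Finset.sum_add_distrib, mul_comm] using h
  have hvN : v ᵥ* N = 0 := by rw [← mulVec_transpose, hN.eq, hv]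
  have h := congrArg (v ⬝ᵥ ·) hD
  simpa [dotProduct_add, dotProduct_mulVec v N, hvN] using h

/-- A vector with nonzero `i`-th entry is the `i`-th column of an invertible matrix. -/
theorem exists_isUnit_det_col_eq {K n : Type*} [Field K] [Fintype n] [DecidableEq n]
    {v : n → K} {i : n} (hi : v i ≠ 0) :
    ∃ B : Matrix n n K, IsUnit B.det ∧ B.col i = v := by
  refine ⟨(1 : Matrix n n K).updateCol i v, ?_, ?_⟩
  · rw [← cramer_apply, cramer_one]
    exact isUnit_iff_ne_zero.mpr hi
  · ext a
    simp [col]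

/-- **Lemma 7.** Let `M₁, …, M_μ` be `ρ × ρ` symmetric matrices over a number field `k`
such that, for every `k`-rational nonsingular congruent transformation `M ↦ Bᵀ M B` and
every index `i`, the `i`-th diagonal entry of some `Bᵀ Mⱼ B` is nonzero.  Then the
determinant `det (∑ⱼ yⱼ Mⱼ)`, as a polynomial in `k[y₁, …, y_μ]`, is not identically
zero. -/
theorem det_sum_smul_ne_zero
    (k : Type) [Field k] [NumberField k] {ρ μ : ℕ}
    (M : Fin μ → Matrix (Fin ρ) (Fin ρ) k)
    (hsymm : ∀ j, (M j).IsSymm)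
    (hdiag : ∀ B : Matrix (Fin ρ) (Fin ρ) k, IsUnit B.det →
      ∀ i : Fin ρ, ∃ j, (Bᵀ * M j * B) i i ≠ 0) :
    Matrix.det (Matrix.of fun a b : Fin ρ =>
        ∑ j, (X j : MvPolynomial (Fin μ) k) * MvPolynomial.C (M j a b)) ≠ 0 := by
  intro hdet
  obtain ⟨v, hv0, hv⟩ := exists_mulVec_eq_zero_iff.mpr hdet
  obtain ⟨i, hi⟩ := Function.ne_iff.mp hv0
  obtain ⟨x, hx⟩ : ∃ x, eval x (v i) ≠ 0 := by
    by_contra! h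
    exact hi (MvPolynomial.funext fun x => by simpa using h x)
  obtain ⟨B, hB, hcol⟩ := exists_isUnit_det_col_eq (v := fun a => eval x (v a)) hx
  obtain ⟨j, hj⟩ := hdiag B hB i
  apply hj
  have hform := dotProduct_map_derivation_mulVec_eq_zero (pderiv (R := k) j)
    (IsSymm.ext fun a b => by simp [fun l => (hsymm l).apply a b]) hv
  have heval := congrArg (eval x) hform
  have hentry : ∀ a, B a i = eval x (v a) := congrFun hcol
  rw [Matrix.mul_assoc]
  simpa [mul_apply, hentry, dotProduct, mulVec, pderiv_X, Pi.single_apply] using heval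
end

section
/- Let k be a number field and let C ∈ k[x_1,…,x_4,y_1,…,y_h] be a cubic form in n = h + 4 variables which is irreducible over an algebraic closure of k, is non-conical, has h-invariant h_k(C) = h with 11 ≤ h, and satisfies C(x,0) ≡ 0. Write C(x,y) = Σ_{i=1}^h y_i Q_i(x) + 2 Σ_{j=1}^4 x_j q_j(y) + c(y), where the Q_i are quadratic forms in x, the q_j are quadratic forms in y, and c is a cubic form in y, and let A(y) be the symmetric 5×5 matrix with upper-left 4×4 block Σ_{i=1}^h y_i M_i (where Q_i(x) = xᵀM_i x), last column and row (q_1(y),…,q_4(y)), and lower-right entry c(y), so that Q_y(x,t) := (x,t)ᵀ A(y) (x,t) satisfies Q_y(x,t)·t = C(x, t·y). Then either det A(y) is a nonzero polynomial in k[y_1,…,y_h] (so Q_y has full rank 5 for all y outside a proper Zariski-closed subset), or the hypersurface C = 0 has a singular k-point, i.e. there is a nonzero a ∈ k^n at which all partial derivatives of C vanish. -/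
open MvPolynomial Matrix

/-- Evaluating a form of degree `n` at a scaled point scales the value by the `n`-th power. -/
lemma MvPolynomial.IsHomogeneous.eval_mul {σ R : Type*} [CommSemiring R] {p : MvPolynomial σ R}
    {n : ℕ} (hp : p.IsHomogeneous n) (t : R) (y : σ → R) :
    eval (fun i => t * y i) p = t ^ n * eval y p := by
  rw [eval_eq, eval_eq, Finset.mul_sum]
  refine Finset.sum_congr rfl fun d hd => ?_
  have hdeg : ∑ i ∈ d.support, d i = n := by
    rw [← hp (mem_support_iff.mp hd)]
    simp [Finsupp.weight_apply, Finsupp.sum]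
  simp only [mul_pow, Finset.prod_mul_distrib, Finset.prod_pow_eq_pow_sum, hdeg]
  ring

/-- The quadratic form of the derivative of a symmetric matrix vanishes on the kernel of the
matrix. -/
lemma Matrix.IsSymm.sum_mul_derivation_mul_eq_zero {ι R S : Type*} [Fintype ι] [CommRing R]
    [CommRing S] [Algebra R S] {A : Matrix ι ι S} (hA : A.IsSymm) {v : ι → S}
    (hv : A *ᵥ v = 0) (D : Derivation R S S) :
    ∑ r, ∑ s, v r * D (A r s) * v s = 0 := by
  have hrow : ∀ r, ∑ s, A r s * v s = 0 := fun r => congrFun hv r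
  have hcol : ∑ r, ∑ s, v r * (A r s * D (v s)) = 0 := by
    rw [Finset.sum_comm]
    refine Finset.sum_eq_zero fun s _ => ?_
    calc ∑ r, v r * (A r s * D (v s)) = (∑ r, A s r * v r) * D (v s) := by
          rw [Finset.sum_mul]
          refine Finset.sum_congr rfl fun r _ => ?_
          rw [← hA.apply r s]
          ring
      _ = 0 := by rw [hrow, zero_mul]
  have hD : ∀ r, ∑ s, (A r s * D (v s) + v s * D (A r s)) = 0 := fun r => by
    simpa [map_sum] using congrArg D (hrow r)
  calc ∑ r, ∑ s, v r * D (A r s) * v s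
      = ∑ r, v r * ∑ s, (A r s * D (v s) + v s * D (A r s))
          - ∑ r, ∑ s, v r * (A r s * D (v s)) := by
        rw [← Finset.sum_sub_distrib]
        refine Finset.sum_congr rfl fun r _ => ?_
        rw [Finset.mul_sum, ← Finset.sum_sub_distrib]
        exact Finset.sum_congr rfl fun s _ => by ring
    _ = 0 := by simp [hD, hcol]

/-- The partial derivatives of the quadratic form of a symmetric matrix. -/
lemma eval_pderiv_of_eval_eq_dotProduct_mulVec {ι k : Type*} [Fintype ι] [DecidableEq ι]
    [CommRing k] [IsDomain k] [Infinite k] {p : MvPolynomial ι k} {M : Matrix ι ι k}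
    (hM : M.IsSymm) (hp : ∀ x, eval x p = x ⬝ᵥ M.mulVec x) (x : ι → k) (j : ι) :
    eval x (pderiv j p) = 2 * ∑ b, M j b * x b := by
  have hpoly : p = ∑ a, ∑ b, X a * (MvPolynomial.C (M a b) * X b) := by
    refine MvPolynomial.funext fun x => ?_
    simp [hp, dotProduct, mulVec, Finset.mul_sum]
  rw [hpoly]
  simp only [map_sum, Derivation.leibniz, pderiv_X, pderiv_C, smul_eq_mul, map_add, map_mul,
    eval_X, eval_C, mul_zero, add_zero, Pi.single_apply, Finset.sum_add_distrib]
  simp only [apply_ite (eval x), map_one, map_zero, mul_ite, mul_one, mul_zero,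
    Finset.sum_ite_eq', Finset.sum_ite_irrel, Finset.sum_const_zero,
    Finset.mem_univ, if_true]
  rw [two_mul]
  congr 1
  refine Finset.sum_congr rfl fun b _ => ?_
  rw [hM.apply, mul_comm]

/-- A polynomial in the first block of variables has zero derivative in the second block. -/
lemma pderiv_inr_rename_inl {σ τ R : Type*} [CommSemiring R] (i : τ) (p : MvPolynomial σ R) :
    pderiv (Sum.inr i) (rename (Sum.inl : σ → σ ⊕ τ) p) = 0 := by
  classical
  refine pderiv_eq_zero_of_notMem_vars fun hi => ?_
  simpa using vars_rename _ p hi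

/-- A polynomial in the second block of variables has zero derivative in the first block. -/
lemma pderiv_inl_rename_inr {σ τ R : Type*} [CommSemiring R] (j : σ) (p : MvPolynomial τ R) :
    pderiv (Sum.inl j) (rename (Sum.inr : τ → σ ⊕ τ) p) = 0 := by
  classical
  refine pderiv_eq_zero_of_notMem_vars fun hj => ?_
  simpa using vars_rename _ p hj

/-- **Lemma 8.** Let `C(x, y)` be a geometrically irreducible, non-conical cubic form over
a number field `k` in variables `x = (x₁, …, x₄)`, `y = (y₁, …, y_h)` with `h`-invariant
`h ≥ 11`, vanishing on the linear space `y = 0`, written as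
`C(x,y) = ∑ᵢ yᵢ Qᵢ(x) + 2 ∑ⱼ xⱼ qⱼ(y) + c(y)` with `Qᵢ(x) = xᵀ Mᵢ x`.  Let `A(y)` be the
symmetric `5 × 5` matrix with upper-left block `∑ᵢ yᵢ Mᵢ`, last column and row
`(q₁(y), …, q₄(y))`, and lower-right entry `c(y)`.  Then either `det A(y)` is a nonzero
polynomial in `k[y₁, …, y_h]`, or the hypersurface `C = 0` has a singular `k`-point. -/
theorem det_ne_zero_or_singular_point
    (k : Type) [Field k] [NumberField k] {h : ℕ}
    (C : MvPolynomial (Fin 4 ⊕ Fin h) k) (hC0 : C ≠ 0) (hhom : C.IsHomogeneous 3)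
    (hgeomint : Irreducible (MvPolynomial.map (algebraMap k (AlgebraicClosure k)) C))
    (hnc : IsNonConical k C)
    (hinv : hInvariant k C = h) (hh : 11 ≤ h)
    (hvanish : aeval (Sum.elim X fun _ => (0 : MvPolynomial (Fin 4) k)) C = 0)
    (Q : Fin h → MvPolynomial (Fin 4) k) (q : Fin 4 → MvPolynomial (Fin h) k)
    (c : MvPolynomial (Fin h) k)
    (hQ : ∀ i, (Q i).IsHomogeneous 2) (hq : ∀ j, (q j).IsHomogeneous 2)
    (hc : c.IsHomogeneous 3)
    (hdecomp : C = ∑ i, X (Sum.inr i) * rename Sum.inl (Q i)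
        + 2 * ∑ j, X (Sum.inl j) * rename Sum.inr (q j)
        + rename Sum.inr c)
    (M : Fin h → Matrix (Fin 4) (Fin 4) k)
    (hMsymm : ∀ i, (M i).IsSymm)
    (hM : ∀ i, ∀ x : Fin 4 → k, eval x (Q i) = x ⬝ᵥ (M i).mulVec x)
    (A : Matrix (Fin 4 ⊕ Unit) (Fin 4 ⊕ Unit) (MvPolynomial (Fin h) k))
    (hA : A = Matrix.fromBlocks
        (Matrix.of fun a b => ∑ i, X i * MvPolynomial.C (M i a b))
        (Matrix.of fun a (_ : Unit) => q a)
        (Matrix.of fun (_ : Unit) b => q b)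
        (Matrix.of fun (_ : Unit) (_ : Unit) => c)) :
    A.det ≠ 0 ∨
      ∃ a : Fin 4 ⊕ Fin h → k, a ≠ 0 ∧ ∀ v, eval a (pderiv v C) = 0 := by
  by_cases hdet : A.det = 0
  swap
  · exact Or.inl hdet
  right
  obtain ⟨v, hv0, hv⟩ := Matrix.exists_mulVec_eq_zero_iff.mpr hdet
  have hAsymm : A.IsSymm := by
    rw [hA]
    refine Matrix.IsSymm.fromBlocks ?_ rfl rfl
    ext a b
    simp [(hMsymm _).apply a b]
  obtain ⟨r, hr⟩ := Function.ne_iff.mp hv0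
  let i₀ : Fin h := ⟨0, by omega⟩
  obtain ⟨y, hy⟩ : ∃ y, eval y (v r * X i₀) ≠ 0 := by
    by_contra! hzero
    exact mul_ne_zero hr (X_ne_zero i₀) (MvPolynomial.funext fun y => by simpa using hzero y)
  rw [map_mul, eval_X] at hy
  set x : Fin 4 → k := fun j => eval y (v (Sum.inl j))
  set t : k := eval y (v (Sum.inr ())) with ht
  refine ⟨Sum.elim x fun i => t * y i, ?_, ?_⟩
  · intro ha
    rcases r with j | u
    · exact left_ne_zero_of_mul hy (congrFun ha (Sum.inl j))
    · exact hy (congrFun ha (Sum.inr i₀))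
  have hcompl : (Sum.elim x fun i => t * y i : Fin 4 ⊕ Fin h → k) ∘ Sum.inl = x := rfl
  have hcompr : (Sum.elim x fun i => t * y i : Fin 4 ⊕ Fin h → k) ∘ Sum.inr =
      fun i => t * y i := rfl
  have htwo : ∀ v, pderiv v (2 : MvPolynomial (Fin 4 ⊕ Fin h) k) = 0 := fun v =>
    Derivation.map_natCast (pderiv v) 2
  rintro (j | i)
  · have hrow := congrArg (eval y) (congrFun hv (Sum.inl j))
    rw [hA] at hrow
    simp only [mulVec, dotProduct, Fintype.sum_sum_type, fromBlocks_apply₁₁, fromBlocks_apply₁₂,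
      of_apply, map_add, map_sum, map_mul, eval_X, eval_C, Finset.univ_unique,
      Finset.sum_singleton, Pi.zero_apply, map_zero, PUnit.default_eq_unit, ← ht] at hrow
    have hform : eval (Sum.elim x fun i => t * y i) (pderiv (Sum.inl j) C) =
        ∑ i, t * y i * (2 * ∑ b, M i j b * x b) + 2 * (t ^ 2 * eval y (q j)) := by
      rw [hdecomp]
      simp only [map_add, map_sum, Derivation.leibniz, smul_eq_mul, pderiv_inl_rename_inr,
        pderiv_rename Sum.inl_injective, map_mul, eval_X, eval_rename, hcompl, hcompr,
        eval_pderiv_of_eval_eq_dotProduct_mulVec (hMsymm _) (hM _), (hq _).eval_mul]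
      simp [pderiv_X, Pi.single_apply, htwo]
    have hswap : ∑ i, t * y i * (2 * ∑ b, M i j b * x b) =
        2 * t * ∑ b, (∑ i, y i * M i j b) * x b := by
      simp only [Finset.mul_sum, Finset.sum_mul]
      rw [Finset.sum_comm]
      exact Finset.sum_congr rfl fun b _ => Finset.sum_congr rfl fun i _ => by ring
    rw [hform, hswap]
    linear_combination 2 * t * hrow
  · have hker := congrArg (eval y) (hAsymm.sum_mul_derivation_mul_eq_zero hv (pderiv (R := k) i))
    rw [hA] at hker
    simp only [Fintype.sum_sum_type, fromBlocks_apply₁₁, fromBlocks_apply₁₂, fromBlocks_apply₂₁,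
      fromBlocks_apply₂₂, of_apply, map_add, map_sum, map_mul, Derivation.leibniz, pderiv_C,
      Finset.univ_unique, Finset.sum_singleton, PUnit.default_eq_unit, ← ht] at hker
    have hform : eval (Sum.elim x fun i => t * y i) (pderiv (Sum.inr i) C) =
        ∑ a, ∑ b, x a * M i a b * x b + 2 * ∑ j, x j * (t * eval y (pderiv i (q j)))
          + t ^ 2 * eval y (pderiv i c) := by
      rw [hdecomp]
      simp only [map_add, map_sum, Derivation.leibniz, smul_eq_mul, pderiv_inr_rename_inl,
        pderiv_rename Sum.inr_injective, map_mul, eval_X, eval_rename, hcompl, hcompr,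
        hM, (hq _).pderiv.eval_mul, hc.pderiv.eval_mul]
      simp [pderiv_X, Pi.single_apply, htwo, dotProduct, mulVec, Finset.mul_sum, mul_assoc]
    have hlin : ∑ j, x j * eval y (pderiv i (q j)) * t = ∑ j, x j * (t * eval y (pderiv i (q j))) :=
      Finset.sum_congr rfl fun j _ => by ring
    have hlin' : ∑ j, t * eval y (pderiv i (q j)) * x j = ∑ j, x j * (t * eval y (pderiv i (q j))) :=
      Finset.sum_congr rfl fun j _ => by ring
    rw [hform]
    simp [pderiv_X, Pi.single_apply, Finset.sum_add_distrib, apply_ite (eval y)] at hker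
    rw [hlin, hlin'] at hker
    linear_combination hker
end

section
/- Let k be a field, let a ∈ k, let M be a 4×4 symmetric matrix over k with upper-left 3×3 submatrix M′, and let A(P) be a 5×5 symmetric matrix with entries in the polynomial ring k[P] of the following shape: the upper-left 4×4 block of A(P) is the constant matrix M; the entries A_{4,5} = A_{5,4} equal a·P² plus a polynomial of degree at most 1 in P; the entries A_{i,5} = A_{5,i} for i = 1,2,3 are polynomials of degree at most 1 in P; and A_{5,5} is a polynomial of degree at most 3 in P. Then det A(P) is a polynomial of degree at most 4 in P, and its coefficient of P⁴ equals −a²·det(M′). In particular, if a ≠ 0 and det(M′) ≠ 0, then det A(P) is a nonzero polynomial in P. -/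
open Matrix Polynomial

/-- Expansion of a determinant along both its last row and its last column. -/
theorem Matrix.det_eq_last_mul_sub_sum {R : Type*} [CommRing R] {n : ℕ}
    (A : Matrix (Fin (n + 2)) (Fin (n + 2)) R) :
    A.det = A (Fin.last _) (Fin.last _) * (A.submatrix Fin.castSucc Fin.castSucc).det -
      ∑ j : Fin (n + 1), ∑ i : Fin (n + 1), (-1) ^ (i + j : ℕ) *
        ((A.submatrix Fin.castSucc Fin.castSucc).submatrix i.succAbove j.succAbove).det *
        (A (Fin.last _) j.castSucc * A i.castSucc (Fin.last _)) := by
  rw [det_succ_row A (Fin.last _), Fin.sum_univ_castSucc, add_comm, sub_eq_add_neg,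
    ← Finset.sum_neg_distrib]
  congr 1
  · simp [Fin.succAbove_last, ← two_mul]
  · refine Finset.sum_congr rfl fun j _ => ?_
    rw [det_succ_column _ (Fin.last n), Finset.mul_sum, ← Finset.sum_neg_distrib]
    refine Finset.sum_congr rfl fun i _ => ?_
    have hminor : ((A.submatrix (Fin.last (n + 1)).succAbove j.castSucc.succAbove).submatrix
        i.succAbove (Fin.last n).succAbove) =
        (A.submatrix Fin.castSucc Fin.castSucc).submatrix i.succAbove j.succAbove := by
      ext x y
      simp [Fin.succAbove_last, Fin.castSucc_succAbove_castSucc]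
    have hlast : j.castSucc.succAbove (Fin.last n) = Fin.last (n + 1) := by
      rw [Fin.succAbove_of_lt_succ _ _ (by simp [Fin.lt_def, Fin.is_le]), Fin.succ_last]
    have hsign : ((-1 : R) ^ n) * (-1) ^ n = 1 := by rw [← mul_pow]; simp
    rw [hminor]
    simp only [submatrix_apply, hlast, Fin.succAbove_last, Fin.val_last, Fin.val_castSucc, pow_add]
    linear_combination (-(-1) ^ (j : ℕ) * (-1) ^ (i : ℕ) *
      ((A.submatrix Fin.castSucc Fin.castSucc).submatrix i.succAbove j.succAbove).det *
      (A (Fin.last _) j.castSucc * A i.castSucc (Fin.last _))) * hsign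

/-- **Determinant expansion in Case 2 of Lemma 3.** Let `A(P)` be a symmetric `5 × 5`
matrix over `k[P]` whose upper-left `4 × 4` block is a constant symmetric matrix `M`,
whose `(4,5)` entry is `a·P² + (degree ≤ 1)`, whose remaining off-block entries have
degree at most `1`, and whose `(5,5)` entry has degree at most `3`.  Then `det A(P)` has
degree at most `4` in `P` with coefficient of `P⁴` equal to `−a² · det M′`, where `M′` is
the upper-left `3 × 3` submatrix of `M`; in particular, if `a ≠ 0` and `det M′ ≠ 0`,
then `det A(P)` is a nonzero polynomial. -/
theorem det_natDegree_le_four_and_coeff_four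
    (k : Type) [Field k] (a : k)
    (M : Matrix (Fin 4) (Fin 4) k) (hM : M.IsSymm)
    (A : Matrix (Fin 5) (Fin 5) k[X]) (hA : A.IsSymm)
    (hblock : ∀ i j : Fin 4, A i.castSucc j.castSucc = Polynomial.C (M i j))
    (h35 : ∃ p : k[X], p.natDegree ≤ 1 ∧
      A 3 4 = Polynomial.C a * Polynomial.X ^ 2 + p)
    (hi5 : ∀ i : Fin 4, i ≠ 3 → (A i.castSucc 4).natDegree ≤ 1)
    (h44 : (A 4 4).natDegree ≤ 3) :
    A.det.natDegree ≤ 4 ∧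
    A.det.coeff 4 = -(a ^ 2) *
      (M.submatrix (Fin.castLE (by norm_num : (3:ℕ) ≤ 4))
          (Fin.castLE (by norm_num : (3:ℕ) ≤ 4))).det ∧
    (a ≠ 0 →
      (M.submatrix (Fin.castLE (by norm_num : (3:ℕ) ≤ 4))
          (Fin.castLE (by norm_num : (3:ℕ) ≤ 4))).det ≠ 0 →
      A.det ≠ 0) := by
  obtain ⟨p, hp, h35⟩ := h35
  set D := (M.submatrix (Fin.castLE (by norm_num : (3:ℕ) ≤ 4))
    (Fin.castLE (by norm_num : (3:ℕ) ≤ 4))).det with hD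
  have hsub : A.submatrix Fin.castSucc Fin.castSucc = M.map C := by
    ext1 i j
    exact hblock i j
  have hdet (m : ℕ) (f g : Fin m → Fin 4) :
      ((M.map C).submatrix f g).det = C (M.submatrix f g).det := by
    rw [RingHom.map_det]
    rfl
  have hv (i : Fin 4) : (A i.castSucc 4).natDegree ≤ 2 := by
    by_cases hi : i = 3
    · subst hi
      change (A 3 4).natDegree ≤ 2
      rw [h35]
      exact natDegree_add_le_of_degree_le (natDegree_C_mul_X_pow_le _ _) (hp.trans (by norm_num))
    · exact (hi5 i hi).trans (by norm_num)
  have hterm (i j : Fin 4) (hij : ¬(i = 3 ∧ j = 3)) (c : k) :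
      (C c * (A j.castSucc 4 * A i.castSucc 4)).natDegree ≤ 3 := by
    refine (natDegree_C_mul_le _ _).trans (natDegree_mul_le.trans ?_)
    by_cases hi : i = 3
    · have := hi5 j fun hj => hij ⟨hi, hj⟩
      have := hv i
      omega
    · have := hi5 i hi
      have := hv j
      omega
  have hlead : ∃ r : k[X], r.natDegree ≤ 3 ∧
      C D * (A 3 4 * A 3 4) = C (a ^ 2 * D) * X ^ 4 + r := by
    refine ⟨C D * (C (2 * a) * X ^ 2 * p + p * p), ?_, ?_⟩
    · refine (natDegree_C_mul_le _ _).trans (natDegree_add_le_of_degree_le ?_ ?_)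
      · exact natDegree_mul_le_of_le (natDegree_C_mul_X_pow_le _ _) hp
      · exact (natDegree_mul_le_of_le hp hp).trans (by norm_num)
    · rw [h35]
      simp only [map_mul, map_pow, map_ofNat]
      ring
  obtain ⟨r, hr, hlead⟩ := hlead
  let c (i j : Fin 4) : k := (-1) ^ (i + j : ℕ) * (M.submatrix i.succAbove j.succAbove).det
  have hc : c 3 3 = D := by
    have hs : (3 : Fin 4).succAbove = Fin.castLE (by norm_num : (3:ℕ) ≤ 4) :=
      Fin.succAbove_last
    simp only [c, hs, hD]
    norm_num
  have hexp : A.det = A 4 4 * C M.det -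
      ∑ x : Fin 4 × Fin 4, C (c x.2 x.1) * (A x.1.castSucc 4 * A x.2.castSucc 4) := by
    have hlast : Fin.last 4 = 4 := rfl
    rw [det_eq_last_mul_sub_sum, hsub, Fintype.sum_prod_type, hlast, ← RingHom.mapMatrix_apply,
      ← RingHom.map_det]
    refine congrArg _ (Finset.sum_congr rfl fun j _ => Finset.sum_congr rfl fun i _ => ?_)
    rw [RingHom.mapMatrix_apply, hdet, hA.apply]
    simp only [c, map_mul, map_pow, map_neg, map_one]
  have hmain : ∃ R : k[X], R.natDegree ≤ 3 ∧ A.det = C (-(a ^ 2) * D) * X ^ 4 + R := by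
    refine ⟨A 4 4 * C M.det - ∑ x ∈ Finset.univ.erase ((3, 3) : Fin 4 × Fin 4),
      C (c x.2 x.1) * (A x.1.castSucc 4 * A x.2.castSucc 4) - r, ?_, ?_⟩
    · refine (natDegree_sub_le _ _).trans (max_le ((natDegree_sub_le _ _).trans (max_le ?_ ?_)) hr)
      · exact (natDegree_mul_C_le _ _).trans h44
      · refine natDegree_sum_le_of_forall_le _ _ fun x hx => hterm _ _ ?_ _
        rintro ⟨h2, h1⟩
        exact Finset.ne_of_mem_erase hx (Prod.ext h1 h2)
    · rw [hexp, ← Finset.add_sum_erase _ _ (Finset.mem_univ ((3, 3) : Fin 4 × Fin 4)), hc]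
      change _ - (C D * (A 3 4 * A 3 4) + _) = _
      rw [hlead]
      simp only [neg_mul, map_neg]
      ring
  obtain ⟨R, hR, hAdet⟩ := hmain
  have hcoeff : A.det.coeff 4 = -(a ^ 2) * D := by
    rw [hAdet, coeff_add, coeff_C_mul_X_pow, coeff_eq_zero_of_natDegree_lt (by omega : _ < 4)]
    simp
  refine ⟨?_, hcoeff, fun ha hD0 h0 => ?_⟩
  · rw [hAdet]
    exact natDegree_add_le_of_degree_le (natDegree_C_mul_X_pow_le _ _) (hR.trans (by norm_num))
  · rw [h0, coeff_zero] at hcoeff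
    exact mul_ne_zero (neg_ne_zero.mpr (pow_ne_zero 2 ha)) hD0 hcoeff.symm
end
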